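/- For every ξ ∈ 𝕄²ˣ²_sym, g(ξ) = sup{τ : ξ − (1/2)(ℂ⁻¹τ) : τ | τ ∈ K}; that is, the explicitly defined function g is the Fenchel conjugate of the function τ ↦ (1/2)(ℂ⁻¹τ):τ + I_K(τ), where I_K is the indicator function of K. -/

import Mathlib

open Matrix Set
open scoped Classical

attribute [local instance] Matrix.frobeniusNormedAddCommGroup Matrix.frobeniusNormedSpace

noncomputable section

/-- The space of real 2×2 matrices (symmetric ones are singled out by `Matrix.IsSymm`). -/
abbrev M2 : Type := Matrix (Fin 2) (Fin 2) ℝ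

/-- Frobenius inner product `A : B = tr (Aᵀ B)`. -/
def inn (A B : M2) : ℝ := (Aᵀ * B).trace

/-- Frobenius norm `|A| = √(A : A)`. -/
def fnorm (A : M2) : ℝ := Real.sqrt (inn A A)

/-- Deviatoric part `A_D = A − (tr A / 2) Id`. -/
def dev (A : M2) : M2 := A - (A.trace / 2) • (1 : M2)

/-- The set of symmetric matrices `𝕄²ˣ²_sym`. -/
def Msym : Set M2 := {A | A.IsSymm}

/-- The Drucker–Prager elasticity set `K = {σ ∈ 𝕄²ˣ²_sym : |σ_D| + α tr σ ≤ κ}`. -/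
def Kset (α κ : ℝ) : Set M2 :=
  {σ | σ.IsSymm ∧ fnorm (dev σ) + α * σ.trace ≤ κ}

/-- The isotropic elasticity tensor `ℂ e = λ (tr e) Id + 2 μ e`. -/
def Cc (lam mu : ℝ) (e : M2) : M2 := (lam * e.trace) • (1 : M2) + (2 * mu) • e

/-- The inverse elasticity tensor `ℂ⁻¹ σ = (tr σ / (4 K₀)) Id + (1/(2μ)) σ_D`, `K₀ = λ + μ`. -/
def Cinv (lam mu : ℝ) (σ : M2) : M2 :=
  (σ.trace / (4 * (lam + mu))) • (1 : M2) + (1 / (2 * mu)) • dev σ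

/-- The constant `β = (1/μ + 1/(2 α² K₀))⁻¹`. -/
def betaC (α lam mu : ℝ) : ℝ := (1 / mu + 1 / (2 * α ^ 2 * (lam + mu)))⁻¹

/-- The function `g`. -/
def gfun (α κ lam mu : ℝ) (ξ : M2) : ℝ :=
  if 2 * mu * fnorm (dev ξ) + 2 * α * (lam + mu) * ξ.trace ≤ κ then
    ((lam + mu) / 2) * ξ.trace ^ 2 + mu * fnorm (dev ξ) ^ 2
  else
    κ * ξ.trace / (2 * α) - κ ^ 2 / (8 * α ^ 2 * (lam + mu)) +
      betaC α lam mu *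
        max (fnorm (dev ξ) - ξ.trace / (2 * α) + κ / (4 * α ^ 2 * (lam + mu))) 0 ^ 2

/-- The (matrix representing the) differential of `g`. -/
def Dg (α κ lam mu : ℝ) (ξ : M2) : M2 :=
  if 2 * mu * fnorm (dev ξ) + 2 * α * (lam + mu) * ξ.trace ≤ κ then
    ((lam + mu) * ξ.trace) • (1 : M2) + (2 * mu) • dev ξ
  else
    (κ / (2 * α)) • (1 : M2) +
      (2 * betaC α lam mu *
          max (fnorm (dev ξ) - ξ.trace / (2 * α) + κ / (4 * α ^ 2 * (lam + mu))) 0) •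
        ((fnorm (dev ξ))⁻¹ • dev ξ - (1 / (2 * α)) • (1 : M2))

/-- The open cone `𝒜₁ = {ξ ∈ 𝕄²ˣ²_sym : μ |ξ_D| + α K₀ tr ξ < 0}`. -/
def A1 (α lam mu : ℝ) : Set M2 :=
  {ξ | ξ.IsSymm ∧ mu * fnorm (dev ξ) + α * (lam + mu) * ξ.trace < 0}

/-- The open cone `𝒜₂ = {ξ ∈ 𝕄²ˣ²_sym : |ξ_D| < tr ξ / (2α)}`. -/
def A2 (α : ℝ) : Set M2 :=
  {ξ | ξ.IsSymm ∧ fnorm (dev ξ) < ξ.trace / (2 * α)}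

/-- The cone `𝒜₃ = 𝕄²ˣ²_sym ∖ (cl 𝒜₁ ∪ cl 𝒜₂)`. -/
def A3 (α lam mu : ℝ) : Set M2 :=
  Msym \ (closure (A1 α lam mu) ∪ closure (A2 α))

/-- The function `G(ξ) = Dg(ξ + (κ/(4αK₀)) Id)`, given by its explicit piecewise expression. -/
def Gfun (α κ lam mu : ℝ) (ξ : M2) : M2 :=
  if ξ ∈ A1 α lam mu then
    (κ / (2 * α)) • (1 : M2) + ((lam + mu) * ξ.trace) • (1 : M2) + (2 * mu) • dev ξ
  else if ξ ∈ A2 α ∨ ξ = 0 then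
    (κ / (2 * α)) • (1 : M2)
  else
    (κ / (2 * α)) • (1 : M2) +
      (2 * betaC α lam mu * (fnorm (dev ξ) - ξ.trace / (2 * α))) •
        ((fnorm (dev ξ))⁻¹ • dev ξ - (1 / (2 * α)) • (1 : M2))

/-- The map `𝒢(ξ, η)`. -/
def calG (α lam mu : ℝ) (ξ η : M2) : M2 :=
  if ξ ∈ A1 α lam mu then
    ((lam + mu) * η.trace) • (1 : M2) + (2 * mu) • dev η
  else if ξ ∈ A2 α ∨ ξ = 0 then
    0
  else
    (2 * betaC α lam mu * (inn (dev ξ) (dev η) / fnorm (dev ξ) - η.trace / (2 * α))) •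
      ((fnorm (dev ξ))⁻¹ • dev ξ - (1 / (2 * α)) • (1 : M2)) +
    (2 * betaC α lam mu * (fnorm (dev ξ) - ξ.trace / (2 * α)) * (fnorm (dev ξ))⁻¹) •
      (dev η - (inn (dev ξ) (dev η) / fnorm (dev ξ) ^ 2) • dev ξ)

/-- The relative boundary `∂𝒜₁` of `𝒜₁` inside `𝕄²ˣ²_sym`. -/
def bdryA1 (α lam mu : ℝ) : Set M2 := closure (A1 α lam mu) \ A1 α lam mu

/-- The relative boundary `∂𝒜₂` of `𝒜₂` inside `𝕄²ˣ²_sym`. -/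
def bdryA2 (α : ℝ) : Set M2 := closure (A2 α) \ A2 α

/-- The outward normal `ν(σ) = μ σ_D/|σ_D| + α K₀ Id` for `σ ∈ ∂𝒜₁ ∖ {0}`. -/
def nu1 (α lam mu : ℝ) (σ : M2) : M2 :=
  (mu * (fnorm (dev σ))⁻¹) • dev σ + (α * (lam + mu)) • (1 : M2)

/-- The outward normal `ν(σ) = σ_D/|σ_D| − (1/(2α)) Id` for `σ ∈ ∂𝒜₂ ∖ {0}`. -/
def nu2 (α : ℝ) (σ : M2) : M2 :=
  (fnorm (dev σ))⁻¹ • dev σ - (1 / (2 * α)) • (1 : M2)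

theorem inn_eq_entries (A B : M2) :
    inn A B = A 0 0 * B 0 0 + A 1 0 * B 1 0 + (A 0 1 * B 0 1 + A 1 1 * B 1 1) := by
  simp [inn, Matrix.trace, Matrix.mul_apply, Fin.sum_univ_two]

theorem inn_self_nonneg (A : M2) : 0 ≤ inn A A := by
  rw [inn_eq_entries]
  nlinarith [sq_nonneg (A 0 0), sq_nonneg (A 1 0), sq_nonneg (A 0 1), sq_nonneg (A 1 1)]

theorem fnorm_nonneg (A : M2) : 0 ≤ fnorm A := Real.sqrt_nonneg _

theorem fnorm_sq (A : M2) : fnorm A ^ 2 = inn A A := Real.sq_sqrt (inn_self_nonneg A)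

theorem inn_le_fnorm_mul_fnorm (A B : M2) : inn A B ≤ fnorm A * fnorm B := by
  refine (abs_le_of_sq_le_sq' ?_ (mul_nonneg (fnorm_nonneg A) (fnorm_nonneg B))).2
  rw [mul_pow, fnorm_sq, fnorm_sq]
  simp only [inn_eq_entries]
  nlinarith [sq_nonneg (A 0 0 * B 1 0 - A 1 0 * B 0 0), sq_nonneg (A 0 0 * B 0 1 - A 0 1 * B 0 0),
    sq_nonneg (A 0 0 * B 1 1 - A 1 1 * B 0 0), sq_nonneg (A 1 0 * B 0 1 - A 0 1 * B 1 0),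
    sq_nonneg (A 1 0 * B 1 1 - A 1 1 * B 1 0), sq_nonneg (A 0 1 * B 1 1 - A 1 1 * B 0 1)]

theorem inn_smul_self (r : ℝ) (A : M2) : inn (r • A) A = r * inn A A := by
  simp only [inn_eq_entries, Matrix.smul_apply, smul_eq_mul]
  ring

theorem fnorm_smul {r : ℝ} (hr : 0 ≤ r) (A : M2) : fnorm (r • A) = r * fnorm A := by
  have h : inn (r • A) (r • A) = r ^ 2 * inn A A := by
    simp only [inn_eq_entries, Matrix.smul_apply, smul_eq_mul]
    ring
  rw [fnorm, h, Real.sqrt_mul (sq_nonneg r), Real.sqrt_sq hr, fnorm]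

theorem inn_eq_trace_add_dev (A B : M2) :
    inn A B = A.trace * B.trace / 2 + inn (dev A) (dev B) := by
  simp [inn_eq_entries, dev, Matrix.trace, Fin.sum_univ_two]
  ring

theorem inn_Cinv_self (lam mu : ℝ) (τ : M2) :
    inn (Cinv lam mu τ) τ = τ.trace ^ 2 / (4 * (lam + mu)) + fnorm (dev τ) ^ 2 / (2 * mu) := by
  rw [fnorm_sq]
  simp [inn_eq_entries, Cinv, dev, Matrix.trace, Fin.sum_univ_two, div_eq_mul_inv]
  ring

theorem trace_dev (A : M2) : (dev A).trace = 0 := by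
  simp [dev, Matrix.trace, Fin.sum_univ_two]
  ring

theorem trace_smul_one_add_smul_dev (t r : ℝ) (A : M2) :
    ((t / 2) • (1 : M2) + r • dev A).trace = t := by
  simp [Matrix.trace_add, Matrix.trace_smul, trace_dev]

theorem dev_smul_one_add_smul_dev (t r : ℝ) (A : M2) :
    dev ((t / 2) • (1 : M2) + r • dev A) = r • dev A := by
  rw [dev, trace_smul_one_add_smul_dev, add_sub_cancel_left]

theorem isSymm_dev {A : M2} (hA : A.IsSymm) : (dev A).IsSymm :=
  hA.sub (Matrix.isSymm_one.smul _)

/-- The dual objective as a function of `t = tr τ` and `s = |τ_D|`, for `τ_D` aligned with `ξ_D`,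
where `x = tr ξ` and `d = |ξ_D|`. -/
def reducedObjective (k mu x d t s : ℝ) : ℝ :=
  t * x / 2 + s * d - t ^ 2 / (8 * k) - s ^ 2 / (4 * mu)

/-- The Karush–Kuhn–Tucker conditions, with multiplier `m`, are sufficient for maximality. -/
theorem reducedObjective_le_of_kkt {α κ k mu x d t s m t' s' : ℝ} (hk : 0 < k)
    (hmu : 0 < mu) (hm : 0 ≤ m) (ht : x / 2 - t / (4 * k) = α * m)
    (hs : d - s / (2 * mu) ≤ m) (hcs : (d - s / (2 * mu) - m) * s = 0)
    (hcm : m * (κ - s - α * t) = 0) (hs' : 0 ≤ s') (hK : s' + α * t' ≤ κ) :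
    reducedObjective k mu x d t' s' ≤ reducedObjective k mu x d t s := by
  have expand : reducedObjective k mu x d t' s' = reducedObjective k mu x d t s
      + (x / 2 - t / (4 * k)) * (t' - t) + (d - s / (2 * mu)) * (s' - s)
      - (t' - t) ^ 2 / (8 * k) - (s' - s) ^ 2 / (4 * mu) := by
    unfold reducedObjective
    field_simp
    ring
  have h1 : 0 ≤ (t' - t) ^ 2 / (8 * k) := by positivity
  have h2 : 0 ≤ (s' - s) ^ 2 / (4 * mu) := by positivity
  have h3 := mul_nonneg hm (sub_nonneg.2 hK)
  have h4 := mul_nonneg (sub_nonneg.2 hs) hs'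
  rw [ht] at expand
  nlinarith

/-- A solution of the Karush–Kuhn–Tucker conditions at which the objective is the value of `g`. -/
theorem exists_kkt {α κ lam mu : ℝ} (hα : 0 < α) (hmu : 0 < mu)
    (hlm : 0 < lam + mu) (ξ : M2) :
    ∃ t s m : ℝ, 0 ≤ m ∧ 0 ≤ s ∧ s ≤ 2 * mu * fnorm (dev ξ) ∧ s + α * t ≤ κ ∧
      ξ.trace / 2 - t / (4 * (lam + mu)) = α * m ∧ fnorm (dev ξ) - s / (2 * mu) ≤ m ∧
      (fnorm (dev ξ) - s / (2 * mu) - m) * s = 0 ∧ m * (κ - s - α * t) = 0 ∧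
      reducedObjective (lam + mu) mu ξ.trace (fnorm (dev ξ)) t s = gfun α κ lam mu ξ := by
  have hd := fnorm_nonneg (dev ξ)
  unfold gfun reducedObjective
  generalize fnorm (dev ξ) = d at *
  generalize ξ.trace = x at *
  generalize hk : lam + mu = k at *
  split_ifs with h
  · refine ⟨2 * k * x, 2 * mu * d, 0, le_rfl, by positivity, le_rfl, by linarith, ?_, ?_, ?_, ?_, ?_⟩
    · field_simp
      ring
    · apply le_of_eq
      field_simp
      ring
    · field_simp
      ring
    · ring
    · field_simp
      ring
  · push Not at h
    rcases le_total (d - x / (2 * α) + κ / (4 * α ^ 2 * k)) 0 with hP | hP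
    · rw [max_eq_right hP]
      refine ⟨κ / α, 0, x / (2 * α) - κ / (4 * α ^ 2 * k), by linarith, le_rfl, by positivity,
        ?_, ?_, ?_, ?_, ?_, ?_⟩
      · apply le_of_eq
        field_simp
        ring
      · field_simp
      · simp only [zero_div]
        linarith
      · ring
      · field_simp
        ring
      · field_simp
        ring
    · rw [max_eq_left hP]
      have hβ : betaC α lam mu = 2 * α ^ 2 * k * mu / (2 * α ^ 2 * k + mu) := by
        unfold betaC
        rw [hk]
        field_simp
      rw [hβ]
      have hβ0 : 0 ≤ 2 * α ^ 2 * k * mu / (2 * α ^ 2 * k + mu) := by positivity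
      set s := 2 * (2 * α ^ 2 * k * mu / (2 * α ^ 2 * k + mu)) *
        (d - x / (2 * α) + κ / (4 * α ^ 2 * k)) with hs
      have hs2 : 2 * mu * d - s =
          mu / (2 * α ^ 2 * k + mu) * (2 * mu * d + 2 * α * k * x - κ) := by
        rw [hs]
        field_simp
        ring
      have hsle : 0 ≤ 2 * mu * d - s := by
        rw [hs2]
        exact mul_nonneg (by positivity) (by linarith)
      refine ⟨(κ - s) / α, s, d - s / (2 * mu), ?_, by positivity, by linarith,
        ?_, ?_, le_rfl, ?_, ?_, ?_⟩
      · rw [sub_nonneg, div_le_iff₀ (by positivity)]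
        linarith
      · apply le_of_eq
        field_simp
        ring
      · rw [hs]
        field_simp
        ring
      · ring
      · field_simp
        ring
      · rw [hs]
        field_simp
        ring

/-- For every symmetric `ξ`,
`g(ξ) = sup {τ : ξ − ½ (ℂ⁻¹τ) : τ | τ ∈ K}`, i.e. `g` is the Fenchel conjugate of
`τ ↦ ½ (ℂ⁻¹τ) : τ + I_K(τ)`. -/
theorem stmt_5 (α κ lam mu : ℝ) (hα : 0 < α) (hκ : 0 < κ) (hmu : 0 < mu)
    (hlm : 0 < lam + mu) (ξ : M2) (hξ : ξ.IsSymm) :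
    IsLUB {x : ℝ | ∃ τ ∈ Kset α κ, x = inn τ ξ - (1 / 2) * inn (Cinv lam mu τ) τ}
      (gfun α κ lam mu ξ) := by
  obtain ⟨t, s, m, hm, hs0, hsd, hK, ht, hsm, hcs, hcm, hval⟩ :=
    exists_kkt (κ := κ) hα hmu hlm ξ
  have hobj (τ : M2) : inn τ ξ - (1 / 2) * inn (Cinv lam mu τ) τ =
      reducedObjective (lam + mu) mu ξ.trace (fnorm (dev ξ)) τ.trace (fnorm (dev τ)) +
        (inn (dev τ) (dev ξ) - fnorm (dev τ) * fnorm (dev ξ)) := by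
    rw [inn_eq_trace_add_dev τ ξ, inn_Cinv_self, reducedObjective]
    field_simp
    ring
  rw [← hval]
  apply IsGreatest.isLUB
  constructor
  · have hd := fnorm_nonneg (dev ξ)
    have hr : s / fnorm (dev ξ) * fnorm (dev ξ) = s := by
      apply div_mul_cancel_of_imp
      intro h
      rw [h] at hsd
      linarith
    have hnorm : fnorm ((s / fnorm (dev ξ)) • dev ξ) = s := by
      rw [fnorm_smul (by positivity), hr]
    refine ⟨(t / 2) • (1 : M2) + (s / fnorm (dev ξ)) • dev ξ, ⟨?_, ?_⟩, ?_⟩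
    · exact (Matrix.isSymm_one.smul _).add ((isSymm_dev hξ).smul _)
    · rwa [dev_smul_one_add_smul_dev, trace_smul_one_add_smul_dev, hnorm]
    · rw [hobj, dev_smul_one_add_smul_dev, trace_smul_one_add_smul_dev, hnorm, inn_smul_self,
        ← fnorm_sq, sq, ← mul_assoc, hr, sub_self, add_zero]
  · rintro _ ⟨τ, ⟨-, hτ⟩, rfl⟩
    rw [hobj]
    linarith [inn_le_fnorm_mul_fnorm (dev τ) (dev ξ),
      reducedObjective_le_of_kkt hlm hmu hm ht hsm hcs hcm (fnorm_nonneg (dev τ)) hτ]
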